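/- arXiv:2001.06709 — 2 statements merged into one kernel-verified Lean document; each statement's English description precedes it below -/
import Mathlib

section
/- Let A and B be k-algebras and let φ: A[s1,...,sn] → B[t1,...,tn] be a k-algebra isomorphism between polynomial extensions. If φ(A) ⊆ B, then φ(A) = B. -/
open scoped TensorProduct

universe u

/-- The polynomial extension `A[t₁,…,tₙ]` of a (possibly noncommutative) `k`-algebra `A`
in `n` central, mutually commuting indeterminates. -/
abbrev PolyExt (A : Type u) [Ring A] (n : ℕ) : Type u :=
  AddMonoidAlgebra A (Fin n →₀ ℕ)

/-- The canonical embedding `A → A[t₁,…,tₙ]` as constant polynomials. -/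
noncomputable def PolyExt.C (k A : Type u) [Field k] [Ring A] [Algebra k A] (n : ℕ) :
    A →ₐ[k] PolyExt A n :=
  AddMonoidAlgebra.singleZeroAlgHom

/-- The `i`-th indeterminate of `A[t₁,…,tₙ]`. -/
noncomputable def PolyExt.X (A : Type u) [Ring A] (n : ℕ) (i : Fin n) : PolyExt A n :=
  AddMonoidAlgebra.single (Finsupp.single i 1) 1

/-- Two rings are Morita equivalent if their categories of right modules are
equivalent (as abelian categories). -/
def MoritaEquivalent (R S : Type u) [Ring R] [Ring S] : Prop :=
  Nonempty (ModuleCat.{u} Rᵐᵒᵖ ≌ ModuleCat.{u} Sᵐᵒᵖ)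

/-- `A` is strongly cancellative: for every `n ≥ 1` and every `k`-algebra `B`, any
`k`-algebra isomorphism `A[s₁,…,sₙ] ≅ B[t₁,…,tₙ]` implies `A ≅ B`. -/
def StronglyCancellative (k A : Type u) [Field k] [Ring A] [Algebra k A] : Prop :=
  ∀ (n : ℕ), 1 ≤ n → ∀ (B : Type u) [Ring B] [Algebra k B],
    Nonempty (PolyExt A n ≃ₐ[k] PolyExt B n) → Nonempty (A ≃ₐ[k] B)

/-- `A` is strongly Morita cancellative: for every `n ≥ 1` and every `k`-algebra `B`,
Morita equivalence of `A[s₁,…,sₙ]` and `B[t₁,…,tₙ]` implies Morita equivalence of `A` and `B`. -/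
def StronglyMoritaCancellative (k A : Type u) [Field k] [Ring A] [Algebra k A] : Prop :=
  ∀ (n : ℕ), 1 ≤ n → ∀ (B : Type u) [Ring B] [Algebra k B],
    MoritaEquivalent (PolyExt A n) (PolyExt B n) → MoritaEquivalent A B

/-- `A` is strongly retractable: every `k`-algebra isomorphism
`φ : A[s₁,…,sₙ] → B[t₁,…,tₙ]` (with `n ≥ 1`) satisfies `φ(A) = B`. -/
def StronglyRetractable (k A : Type u) [Field k] [Ring A] [Algebra k A] : Prop :=
  ∀ (n : ℕ), 1 ≤ n → ∀ (B : Type u) [Ring B] [Algebra k B]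
    (φ : PolyExt A n ≃ₐ[k] PolyExt B n),
    φ '' Set.range (PolyExt.C k A n) = Set.range (PolyExt.C k B n)

/-- `A` is strongly detectable: for every `k`-algebra isomorphism
`φ : A[s₁,…,sₙ] → B[t₁,…,tₙ]` (with `n ≥ 1`), the subalgebra of `B[t₁,…,tₙ]` generated by
`B` together with `φ(s₁),…,φ(sₙ)` is all of `B[t₁,…,tₙ]`. -/
def StronglyDetectable (k A : Type u) [Field k] [Ring A] [Algebra k A] : Prop :=
  ∀ (n : ℕ), 1 ≤ n → ∀ (B : Type u) [Ring B] [Algebra k B]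
    (φ : PolyExt A n ≃ₐ[k] PolyExt B n),
    Algebra.adjoin k
      (Set.range (PolyExt.C k B n) ∪ Set.range fun i => φ (PolyExt.X A n i)) = ⊤

/-- A surjective endomorphism of a commutative Noetherian ring is injective. -/
theorem RingHom.injective_of_surjective_of_isNoetherianRing {R : Type*} [CommRing R]
    [IsNoetherianRing R] (f : R →+* R) (hf : Function.Surjective f) :
    Function.Injective f := by
  rw [injective_iff_map_eq_zero]
  intro x hx
  obtain ⟨N, hN⟩ := monotone_stabilizes_iff_noetherian.mpr ‹IsNoetherianRing R›
    { toFun := fun m => RingHom.ker (f ^ m)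
      monotone' := monotone_nat_of_le_succ fun m y hy => by
        rw [RingHom.mem_ker] at hy ⊢
        rw [pow_succ', RingHom.mul_def, RingHom.comp_apply, hy, map_zero] }
  have hsurj : Function.Surjective (f ^ N) := by
    rw [RingHom.coe_pow]
    exact hf.iterate N
  obtain ⟨y, rfl⟩ := hsurj x
  have hy : y ∈ RingHom.ker (f ^ (N + 1)) := by
    rw [RingHom.mem_ker, pow_succ', RingHom.mul_def, RingHom.comp_apply, hx]
  have heq : RingHom.ker (f ^ N) = RingHom.ker (f ^ (N + 1)) := hN (N + 1) N.le_succ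
  rw [← heq] at hy
  exact hy

namespace MvPolynomial

/-- A one-sided inverse of a polynomial substitution in finitely many variables over a
Noetherian ring is two-sided. -/
theorem bind₁_eq_X_of_isNoetherianRing {σ R : Type*} [Finite σ] [CommRing R]
    [IsNoetherianRing R] {p g : σ → MvPolynomial σ R} (h : ∀ i, bind₁ p (g i) = X i) (i : σ) :
    bind₁ g (p i) = X i := by
  have hpg : ∀ q, bind₁ p (bind₁ g q) = q := fun q => by
    rw [bind₁_bind₁]
    simp only [h, bind₁_X_left, AlgHom.id_apply]
  refine RingHom.injective_of_surjective_of_isNoetherianRing (bind₁ p).toRingHom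
    (fun q => ⟨bind₁ g q, hpg q⟩) ?_
  change bind₁ p (bind₁ g (p i)) = bind₁ p (X i)
  rw [hpg, bind₁_X_right]

/-- A one-sided inverse of a polynomial substitution in finitely many variables over a
commutative ring is two-sided. -/
theorem bind₁_eq_X_comm {σ R : Type*} [Finite σ] [CommRing R]
    {p g : σ → MvPolynomial σ R} (h : ∀ i, bind₁ p (g i) = X i) (i : σ) :
    bind₁ g (p i) = X i := by
  let S : Set R := ⋃ i, ((p i).coeffs ∪ (g i).coeffs : Set R)
  have hS : S.Finite := Set.finite_iUnion fun i =>
    (Finset.finite_toSet _).union (Finset.finite_toSet _)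
  let R₀ := Algebra.adjoin ℤ S
  have hfg : R₀.FG := Subalgebra.fg_def.mpr ⟨S, hS, rfl⟩
  have : Algebra.FiniteType ℤ R₀ := R₀.fg_iff_finiteType.mp hfg
  have : IsNoetherianRing R₀ := Algebra.FiniteType.isNoetherianRing ℤ R₀
  let ι : R₀ →+* R := R₀.val.toRingHom
  have hι : Function.Injective ι := Subtype.val_injective
  have hlift : ∀ q : MvPolynomial σ R, (q.coeffs : Set R) ⊆ S → ∃ q₀, map ι q₀ = q :=
    fun q hq => mem_range_map_iff_coeffs_subset.mpr fun r hr =>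
      ⟨⟨r, Algebra.subset_adjoin (hq hr)⟩, rfl⟩
  choose p₀ hp₀ using fun i => hlift (p i)
    (Set.subset_union_left.trans (Set.subset_iUnion_of_subset i subset_rfl))
  choose g₀ hg₀ using fun i => hlift (g i)
    (Set.subset_union_right.trans (Set.subset_iUnion_of_subset i subset_rfl))
  have h₀ : ∀ i, bind₁ p₀ (g₀ i) = X i := fun i => by
    apply map_injective ι hι
    rw [map_bind₁, map_X, hg₀]
    simp only [hp₀, h]
  have := congrArg (map ι) (bind₁_eq_X_of_isNoetherianRing h₀ i)
  rw [map_bind₁, map_X, hp₀] at this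
  simpa only [hg₀] using this

end MvPolynomial

namespace PolyExt

variable {A : Type u} [Ring A] {n : ℕ}

/-- The evaluation `A[t₁,…,tₙ] → A` at `t₁ = ⋯ = tₙ = 0`. -/
noncomputable def constantCoeff (A : Type u) [Ring A] (n : ℕ) : PolyExt A n →+* A :=
  AddMonoidAlgebra.liftNCRingHom (RingHom.id A)
    { toFun := fun m => if m.toAdd = 0 then 1 else 0
      map_one' := if_pos rfl
      map_mul' := fun m m' => by
        simp only [toAdd_mul, add_eq_zero, ite_and, mul_ite, mul_one, mul_zero]
        split_ifs <;> rfl }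
    fun a m => by
      change Commute a (if m.toAdd = 0 then 1 else 0)
      split_ifs
      exacts [Commute.one_right a, Commute.zero_right a]

theorem constantCoeff_single_zero (a : A) :
    constantCoeff A n (AddMonoidAlgebra.single 0 a) = a :=
  (AddMonoidAlgebra.liftNCRingHom_single _ _ _ _ _).trans (mul_one a)

/-- The inclusion `Z(A)[t₁,…,tₙ] → A[t₁,…,tₙ]`. -/
noncomputable def centerInclusion (A : Type u) [Ring A] (n : ℕ) :
    MvPolynomial (Fin n) (Subring.center A) →+* PolyExt A n :=
  AddMonoidAlgebra.mapRingHom (Fin n →₀ ℕ) (Subring.center A).subtype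

theorem centerInclusion_monomial (m : Fin n →₀ ℕ) (z : Subring.center A) :
    centerInclusion A n (MvPolynomial.monomial m z) = AddMonoidAlgebra.single m (z : A) :=
  AddMonoidAlgebra.mapRingHom_single _ _ _

theorem centerInclusion_C (z : Subring.center A) :
    centerInclusion A n (MvPolynomial.C z) = AddMonoidAlgebra.single 0 (z : A) :=
  centerInclusion_monomial 0 z

theorem centerInclusion_X (i : Fin n) :
    centerInclusion A n (MvPolynomial.X i) = X A n i := by
  simp only [MvPolynomial.X, centerInclusion_monomial, X, OneMemClass.coe_one]

theorem X_mem_center (i : Fin n) : X A n i ∈ Subring.center (PolyExt A n) := by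
  rw [Subring.mem_center_iff]
  intro q
  exact (AddMonoidAlgebra.single_commute (fun m => add_comm _ m)
    (fun r => Commute.one_left r) q).symm

theorem exists_centerInclusion_eq {q : PolyExt A n}
    (hq : q ∈ Subring.center (PolyExt A n)) : ∃ q₀, centerInclusion A n q₀ = q := by
  have hmem : q ∈ Set.range (AddMonoidAlgebra.map (M := Fin n →₀ ℕ)
      ((Subring.center A).subtype : Subring.center A →+ A)) := by
    rw [AddMonoidAlgebra.range_map]
    intro m
    refine ⟨⟨q.coeff m, Subring.mem_center_iff.mpr fun a => ?_⟩, rfl⟩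
    have := congrArg (fun x => x.coeff m)
      (Subring.mem_center_iff.mp hq (AddMonoidAlgebra.single 0 a))
    simpa only [AddMonoidAlgebra.coeff_single_zero_mul,
      AddMonoidAlgebra.coeff_mul_single_zero] using this
  exact hmem

/-- A ring endomorphism of `A[t₁,…,tₙ]` fixing `A` and mapping central elements onto the
indeterminates is injective, provided the indeterminates have central images. -/
theorem injective_of_central_preimages (ψ : PolyExt A n →+* PolyExt A n)
    (hψ : ∀ a, ψ (AddMonoidAlgebra.single 0 a) = AddMonoidAlgebra.single 0 a)
    (hX : ∀ i, ψ (X A n i) ∈ Subring.center (PolyExt A n))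
    (hpre : ∀ i, ∃ q ∈ Subring.center (PolyExt A n), ψ q = X A n i) :
    Function.Injective ψ := by
  let j := centerInclusion A n
  have hj : Function.Injective j := AddMonoidAlgebra.map_injective _ Subtype.val_injective
  choose p hp using fun i => exists_centerInclusion_eq (hX i)
  choose q hq hψq using hpre
  choose g hg using fun i => exists_centerInclusion_eq (hq i)
  have hcomm : ∀ r, ψ (j r) = j (MvPolynomial.bind₁ p r) := by
    refine RingHom.congr_fun (f := ψ.comp j)
      (g := j.comp (MvPolynomial.bind₁ p).toRingHom) (MvPolynomial.ringHom_ext ?_ ?_)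
    · intro z
      change ψ (j _) = j (MvPolynomial.bind₁ p _)
      rw [MvPolynomial.bind₁_C_right, centerInclusion_C, hψ]
    · intro i
      change ψ (j _) = j (MvPolynomial.bind₁ p _)
      rw [MvPolynomial.bind₁_X_right, centerInclusion_X, hp]
  have hpg : ∀ i, MvPolynomial.bind₁ p (g i) = MvPolynomial.X i := fun i => by
    apply hj
    rw [← hcomm, hg, hψq, centerInclusion_X]
  have hgp : ∀ r, MvPolynomial.bind₁ g (MvPolynomial.bind₁ p r) = r := fun r => by
    rw [MvPolynomial.bind₁_bind₁]
    simp only [MvPolynomial.bind₁_eq_X_comm hpg, MvPolynomial.bind₁_X_left, AlgHom.id_apply]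
  let Γ : PolyExt A n →+ PolyExt A n :=
    AddMonoidAlgebra.liftNC (AddMonoidAlgebra.singleAddHom 0)
      fun m => j (MvPolynomial.bind₁ g (MvPolynomial.monomial m.toAdd 1))
  have hΓs : ∀ m a, Γ (AddMonoidAlgebra.single m a) = AddMonoidAlgebra.single 0 a *
      j (MvPolynomial.bind₁ g (MvPolynomial.monomial m 1)) := fun m a =>
    AddMonoidAlgebra.liftNC_single _ _ _ _
  have hΓ : ∀ a r, Γ (AddMonoidAlgebra.single 0 a * j r) =
      AddMonoidAlgebra.single 0 a * j (MvPolynomial.bind₁ g r) := by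
    intro a r
    induction r using MvPolynomial.induction_on' with
    | monomial m z =>
      have hz : MvPolynomial.monomial m z =
          MvPolynomial.C z * MvPolynomial.monomial m (1 : Subring.center A) := by
        rw [MvPolynomial.C_mul_monomial, mul_one]
      rw [centerInclusion_monomial, AddMonoidAlgebra.single_mul_single, zero_add, hΓs, hz,
        map_mul, map_mul, MvPolynomial.bind₁_C_right, centerInclusion_C, ← mul_assoc,
        AddMonoidAlgebra.single_mul_single, zero_add]
    | add r s hr hs => simp only [map_add, mul_add, hr, hs]
  have hsplit : ∀ (m : Fin n →₀ ℕ) (a : A), AddMonoidAlgebra.single m a =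
      AddMonoidAlgebra.single 0 a * j (MvPolynomial.monomial m 1) := fun m a => by
    rw [centerInclusion_monomial, AddMonoidAlgebra.single_mul_single, zero_add,
      OneMemClass.coe_one, mul_one]
  have hinv : ∀ x, Γ (ψ x) = x := by
    refine DFunLike.congr_fun (f := Γ.comp ψ.toAddMonoidHom) (g := AddMonoidHom.id _)
      (AddMonoidAlgebra.addMonoidHom_ext fun m a => ?_)
    change Γ (ψ _) = _
    rw [hsplit, map_mul, hψ, hcomm, hΓ, hgp]
    rfl
  exact Function.LeftInverse.injective hinv

end PolyExt

/-- If `φ : A[s₁,…,sₙ] → B[t₁,…,tₙ]` is a `k`-algebra isomorphism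
with `φ(A) ⊆ B`, then `φ(A) = B`. -/
theorem image_eq_of_image_subset
    (k A B : Type u) [Field k] [Ring A] [Ring B] [Algebra k A] [Algebra k B]
    (n : ℕ) (φ : PolyExt A n ≃ₐ[k] PolyExt B n)
    (h : φ '' Set.range (PolyExt.C k A n) ⊆ Set.range (PolyExt.C k B n)) :
    φ '' Set.range (PolyExt.C k A n) = Set.range (PolyExt.C k B n) := by
  refine h.antisymm ?_
  have hC : ∀ a, ∃ b, AddMonoidAlgebra.single 0 b = φ (AddMonoidAlgebra.single 0 a) :=
    fun a => h ⟨_, ⟨a, rfl⟩, rfl⟩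
  choose ι hι using hC
  let π : B →+* A := (PolyExt.constantCoeff A n).comp
    ((φ.symm : PolyExt B n →+* PolyExt A n).comp AddMonoidAlgebra.singleZeroRingHom)
  have hπι : ∀ a, π (ι a) = a := fun a => by
    change PolyExt.constantCoeff A n (φ.symm (AddMonoidAlgebra.single 0 (ι a))) = a
    rw [hι, AlgEquiv.symm_apply_apply, PolyExt.constantCoeff_single_zero]
  let Ψ : PolyExt B n →+* PolyExt A n := AddMonoidAlgebra.mapRingHom _ π
  have hΨ : Function.Surjective Ψ :=
    AddMonoidAlgebra.map_surjective _ fun a => ⟨ι a, hπι a⟩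
  let ψ : PolyExt A n →+* PolyExt A n := Ψ.comp (φ : PolyExt A n →+* PolyExt B n)
  have hψ : Function.Surjective ψ := hΨ.comp φ.surjective
  have hψinj : Function.Injective ψ := by
    refine PolyExt.injective_of_central_preimages ψ (fun a => ?_) (fun i => ?_) (fun i => ?_)
    · change Ψ (φ _) = _
      rw [← hι, AddMonoidAlgebra.mapRingHom_single, hπι]
    · rw [Subring.mem_center_iff]
      intro y
      obtain ⟨x, rfl⟩ := hψ y
      rw [← map_mul, ← map_mul, Subring.mem_center_iff.mp (PolyExt.X_mem_center i)]
    · refine ⟨φ.symm (PolyExt.X B n i), Subring.mem_center_iff.mpr fun y => ?_, ?_⟩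
      · apply φ.injective
        rw [map_mul, map_mul, AlgEquiv.apply_symm_apply,
          Subring.mem_center_iff.mp (PolyExt.X_mem_center i)]
      · change Ψ (φ _) = _
        rw [AlgEquiv.apply_symm_apply, PolyExt.X, AddMonoidAlgebra.mapRingHom_single, map_one,
          PolyExt.X]
  rintro _ ⟨b, rfl⟩
  refine ⟨_, ⟨π b, rfl⟩, φ.symm.injective (hψinj ?_)⟩
  change Ψ (φ (φ.symm (φ (AddMonoidAlgebra.single 0 (π b))))) =
    Ψ (φ (φ.symm (AddMonoidAlgebra.single 0 b)))
  rw [AlgEquiv.apply_symm_apply, AlgEquiv.apply_symm_apply, ← hι,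
    AddMonoidAlgebra.mapRingHom_single, AddMonoidAlgebra.mapRingHom_single, hπι]
end

section
/- Let A be a commutative k-algebra that is an integral domain and suppose that the divisor subalgebra D_A(1) equals A. Then A is strongly retractable. -/
open scoped TensorProduct

universe u

/-- `Sw(F)`: the set of all `g` such that `f = a * g * b` for some `a, b` and some
nonzero `f ∈ F` (the set of subwords of elements of `F`). -/
def subwords {A : Type u} [Ring A] (F : Set A) : Set A :=
  {g | ∃ f ∈ F, f ≠ 0 ∧ ∃ a b : A, f = a * g * b}

/-- The `n`-th stage `Dₙ(F)` in the construction of the divisor subalgebra: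
`D₀(F) = F` and `Dₙ₊₁(F)` is the `k`-subalgebra generated by `Sw(Dₙ(F))`. -/
def divisorStage (k : Type u) {A : Type u} [Field k] [Ring A] [Algebra k A] :
    ℕ → Set A → Set A
  | 0, F => F
  | n + 1, F => (Algebra.adjoin k (subwords (divisorStage k n F)) : Subalgebra k A)

/-- The divisor subalgebra `𝔻_A(F) = ⋃ₙ Dₙ(F)`. -/
def divisorSubalgebra (k : Type u) {A : Type u} [Field k] [Ring A] [Algebra k A]
    (F : Set A) : Set A :=
  ⋃ n, divisorStage k n F

namespace MvPolynomial

variable {σ : Type*}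

theorem mem_range_C_of_dvd_C {R : Type*} [CommRing R] [IsDomain R]
    {p : MvPolynomial σ R} {r : R} (hr : r ≠ 0) (hp : p ∣ C r) :
    p ∈ Set.range (C : R →+* MvPolynomial σ R) := by
  obtain ⟨q, hq⟩ := hp
  have hC : (C r : MvPolynomial σ R) ≠ 0 := by simpa using hr
  rw [hq] at hC
  have hdeg := totalDegree_mul_of_isDomain (left_ne_zero_of_mul hC) (right_ne_zero_of_mul hC)
  rw [← hq, totalDegree_C] at hdeg
  exact ⟨_, (totalDegree_eq_zero_iff_eq_C.mp (by omega)).symm⟩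

theorem mem_range_C_of_isAlgebraic {R : Type*} [CommRing R] [IsDomain R]
    {p : MvPolynomial σ R} (hp : IsAlgebraic R p) :
    p ∈ Set.range (C : R →+* MvPolynomial σ R) := by
  by_cases h0 : p = 0
  · exact ⟨0, by simp [h0]⟩
  obtain ⟨r, hr, hdvd⟩ := hp.exists_nonzero_dvd (mem_nonZeroDivisors_of_ne_zero h0)
  exact mem_range_C_of_dvd_C hr hdvd

/-- If `A[σ] ≃ B[σ]` carries `A` into `B`, with `σ` finite, then it carries `A` onto `B`:
comparing transcendence degrees, `B` is algebraic over `A`, and `A` is algebraically closed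
in `A[σ]`. -/
theorem image_range_C_eq_of_subset [Finite σ] {A B : Type u} [CommRing A] [IsDomain A]
    [CommRing B] [IsDomain B] (φ : MvPolynomial σ A ≃+* MvPolynomial σ B)
    (h : φ '' Set.range (C : A →+* MvPolynomial σ A) ⊆
      Set.range (C : B →+* MvPolynomial σ B)) :
    φ '' Set.range (C : A →+* MvPolynomial σ A) =
      Set.range (C : B →+* MvPolynomial σ B) := by
  refine h.antisymm ?_
  let θ : A →+* B := constantCoeff.comp (φ.toRingHom.comp C)
  have hθ (a : A) : φ (C a) = C (θ a) := by
    obtain ⟨b, hb⟩ := h ⟨_, ⟨a, rfl⟩, rfl⟩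
    simp [θ, ← hb]
  let _ : Algebra A B := θ.toAlgebra
  have hinj : Function.Injective (algebraMap A B) := fun a a' haa' =>
    C_injective σ A <| φ.injective <| by
      rw [hθ, hθ]
      exact congrArg C haa'
  have : FaithfulSMul A B := (faithfulSMul_iff_algebraMap_injective A B).mpr hinj
  let e : MvPolynomial σ A ≃ₐ[A] MvPolynomial σ B := AlgEquiv.ofRingEquiv (f := φ) hθ
  have htr := lift_trdeg_add_eq A B (MvPolynomial σ B)
  rw [← e.trdeg_eq, trdeg_of_isDomain, trdeg_of_isDomain] at htr
  have hzero : Algebra.trdeg A B = 0 := by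
    rw [← Cardinal.lift_eq_zero]
    refine Cardinal.eq_of_add_eq_add_right (htr.trans ?_) ?_
    all_goals simp
  have : Algebra.IsAlgebraic A B := trdeg_eq_zero_iff.mp hzero
  rintro _ ⟨b, rfl⟩
  have hb : IsAlgebraic A (e.symm (C b)) :=
    ((Algebra.IsAlgebraic.isAlgebraic (R := A) b).algebraMap (A := MvPolynomial σ B)).algHom
      e.symm.toAlgHom
  exact ⟨_, mem_range_C_of_isAlgebraic hb, e.apply_symm_apply _⟩

end MvPolynomial

/-- A subalgebra closed under divisors of its nonzero elements, and containing `F`, contains the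
divisor subalgebra generated by `F`. -/
theorem divisorSubalgebra_subset (k : Type u) {A : Type u} [Field k] [Ring A] [Algebra k A]
    {F : Set A} (S : Subalgebra k A) (hF : F ⊆ S) (hS : subwords (S : Set A) ⊆ S) :
    divisorSubalgebra k F ⊆ S := by
  refine Set.iUnion_subset fun n => ?_
  induction n with
  | zero => exact hF
  | succ n ih =>
    refine Algebra.adjoin_le fun g hg => hS ?_
    obtain ⟨f, hf, hf0, a, b, hfab⟩ := hg
    exact ⟨f, ih hf, hf0, a, b, hfab⟩

theorem image_range_C_subset_of_divisorSubalgebra_eq_univ {k A B : Type u} [Field k]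
    [CommRing A] [Algebra k A] [CommRing B] [IsDomain B] [Algebra k B] {σ : Type*}
    (h : divisorSubalgebra k ({1} : Set A) = Set.univ)
    (φ : MvPolynomial σ A ≃ₐ[k] MvPolynomial σ B) :
    φ '' Set.range (MvPolynomial.C : A →+* MvPolynomial σ A) ⊆
      Set.range (MvPolynomial.C : B →+* MvPolynomial σ B) := by
  let CA : A →ₐ[k] MvPolynomial σ A := IsScalarTower.toAlgHom k A _
  let CB : B →ₐ[k] MvPolynomial σ B := IsScalarTower.toAlgHom k B _
  have hS := divisorSubalgebra_subset k (F := ({1} : Set A))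
    (CB.range.comap (φ.toAlgHom.comp CA)) (Set.singleton_subset_iff.mpr (one_mem _)) <| by
      rintro g ⟨f, ⟨b, hb⟩, hf0, a, c, rfl⟩
      have hb' : MvPolynomial.C b = φ (MvPolynomial.C (a * g * c)) := hb
      refine MvPolynomial.mem_range_C_of_dvd_C (r := b) ?_ (p := φ (MvPolynomial.C g)) ?_
      · rintro rfl
        apply hf0
        exact MvPolynomial.C_injective σ A <| φ.injective <| by rw [← hb', map_zero, map_zero, map_zero]
      · rw [hb']
        exact map_dvd φ (map_dvd MvPolynomial.C ⟨a * c, by ring⟩)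
  rintro _ ⟨_, ⟨a, rfl⟩, rfl⟩
  exact hS (h ▸ Set.mem_univ a)

/-- If `A` is a commutative domain with `𝔻_A(1) = A`, then `A` is
strongly retractable. -/
theorem strongly_retractable_of_divisor_subalgebra_eq_top
    (k A : Type u) [Field k] [CommRing A] [Algebra k A] [IsDomain A]
    (h : divisorSubalgebra k ({1} : Set A) = Set.univ) :
    StronglyRetractable k A := by
  intro n _ B _ _ φ
  have hmul (x y : B) : x * y = y * x := by
    have hinj : Function.Injective (PolyExt.C k B n) :=
      AddMonoidAlgebra.single_right_injective
    apply hinj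
    apply φ.symm.injective
    simp only [map_mul]
    exact mul_comm (G := MvPolynomial (Fin n) A) _ _
  let _ : CommRing B := { ‹Ring B› with mul_comm := hmul }
  let ψ : MvPolynomial (Fin n) A ≃ₐ[k] MvPolynomial (Fin n) B := φ
  have : IsDomain (MvPolynomial (Fin n) B) := ψ.symm.toMulEquiv.isDomain _
  have : IsDomain B := (MvPolynomial.C_injective (Fin n) B).isDomain MvPolynomial.C
  exact MvPolynomial.image_range_C_eq_of_subset ψ.toRingEquiv
    (image_range_C_subset_of_divisorSubalgebra_eq_univ h ψ)
end
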